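/- For every x ≥ 0, if T_a^{(x),+} < τ_0^{(x),−}, then for all t ∈ [0, T_a^{(x),+}) one has U^{(x)}(t) = x + f(t) and L^{(x)}(t) = 0; moreover T_a^{(x),+} = inf{t ≥ 0 : L^{(x)}(t) > 0}. -/

import Mathlib

open Filter Set

/-- A càdlàg function: right-continuous with left limits. -/
def CadlagFun (f : ℝ → ℝ) : Prop :=
  (∀ t : ℝ, ContinuousWithinAt f (Set.Ici t) t) ∧
  (∀ t : ℝ, ∃ l : ℝ, Tendsto f (nhdsWithin t (Set.Iio t)) (nhds l))

/-- A strictly increasing sequence of times starting at `0` and tending to `∞`. -/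
def IsTimeGrid (T : ℕ → ℝ) : Prop :=
  T 0 = 0 ∧ StrictMono T ∧ Tendsto T atTop atTop

/-- The periodic-classical reflected triple `(U, L, R)` of the path `t ↦ y + f t`:
classical reflection below at level `0`, periodic reflection above at level `a` at the
times `T k`, defined by the recursive specification. -/
structure IsPCTriple (a : ℝ) (T : ℕ → ℝ) (f : ℝ → ℝ) (y : ℝ)
    (U L R : ℝ → ℝ) : Prop where
  L_first : ∀ t : ℝ, 0 ≤ t → t < T 1 → L t = 0
  R_first : ∀ t : ℝ, 0 ≤ t → t < T 1 →
    R t = max 0 (-sInf ((fun s => y + f s) '' Set.Icc 0 t))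
  U_first : ∀ t : ℝ, 0 ≤ t → t < T 1 → U t = y + f t + R t
  R_seg : ∀ (k : ℕ) (t : ℝ), T k < t → t < T (k + 1) →
    R t = R (T k) + max 0 (-sInf ((fun s => U (T k) + f s - f (T k)) '' Set.Icc (T k) t))
  U_seg : ∀ (k : ℕ) (t : ℝ), T k < t → t < T (k + 1) →
    U t = (U (T k) + f t - f (T k)) + (R t - R (T k))
  L_seg : ∀ (k : ℕ) (t : ℝ), T k < t → t < T (k + 1) → L t = L (T k)
  R_jump : ∀ k : ℕ, R (T (k + 1)) = R (T k) +
    max 0 (-sInf ((fun s => U (T k) + f s - f (T k)) '' Set.Icc (T k) (T (k + 1))))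
  L_jump : ∀ k : ℕ, L (T (k + 1)) = L (T k) +
    max (((U (T k) + f (T (k + 1)) - f (T k)) + (R (T (k + 1)) - R (T k))) - a) 0
  U_jump : ∀ k : ℕ, U (T (k + 1)) =
    min ((U (T k) + f (T (k + 1)) - f (T k)) + (R (T (k + 1)) - R (T k))) a

/-- `τ_0^{(y),-} = inf {t ≥ 0 : y + f t < 0}`, with `inf ∅ = +∞`, as an extended real. -/
noncomputable def tauMinus (f : ℝ → ℝ) (y : ℝ) : EReal :=
  sInf ((fun t : ℝ => (t : EReal)) '' {t : ℝ | 0 ≤ t ∧ y + f t < 0})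

/-- `T_a^{(y),+} = inf {T k : k ≥ 1, y + f (T k) > a}`, with `inf ∅ = +∞`. -/
noncomputable def TPlus (a : ℝ) (T : ℕ → ℝ) (f : ℝ → ℝ) (y : ℝ) : EReal :=
  sInf ((fun t : ℝ => (t : EReal)) ''
    {t : ℝ | ∃ k : ℕ, 1 ≤ k ∧ t = T k ∧ a < y + f (T k)})

/-- The running reflection term at `0` vanishes for a path that stays nonnegative. -/
theorem max_zero_neg_sInf_image_eq_zero {g : ℝ → ℝ} {s : Set ℝ} (h : ∀ u ∈ s, 0 ≤ g u) :
    max 0 (-sInf (g '' s)) = 0 := by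
  have : 0 ≤ sInf (g '' s) := by
    apply Real.sInf_nonneg
    rintro _ ⟨u, hu, rfl⟩
    exact h u hu
  exact max_eq_left (by linarith)

/-- Before `τ_0^{(y),-}` the path is nonnegative. -/
theorem nonneg_of_lt_tauMinus {f : ℝ → ℝ} {y t : ℝ} (ht : 0 ≤ t)
    (h : (t : EReal) < tauMinus f y) : 0 ≤ y + f t := by
  by_contra! hneg
  exact h.not_ge (sInf_le ⟨t, ⟨ht, hneg⟩, rfl⟩)

/-- Every nonnegative time lies in one of the half-open intervals of a time grid. -/
theorem IsTimeGrid.exists_mem_Ico {T : ℕ → ℝ} (hT : IsTimeGrid T) {t : ℝ} (ht : 0 ≤ t) :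
    ∃ k, T k ≤ t ∧ t < T (k + 1) := by
  classical
  have hex : ∃ n, t < T n := (hT.2.2.eventually_gt_atTop t).exists
  obtain ⟨k, hk⟩ : ∃ k, Nat.find hex = k + 1 := by
    refine Nat.exists_eq_succ_of_ne_zero fun h => ?_
    have := Nat.find_spec hex
    rw [h, hT.1] at this
    linarith
  refine ⟨k, not_lt.1 (Nat.find_min hex (by omega)), ?_⟩
  rw [← hk]
  exact Nat.find_spec hex

/-- If `T_a^{(y),+}` is finite, it is the first grid time at which the path exceeds `a`. -/
theorem exists_TPlus_eq {a y : ℝ} {T : ℕ → ℝ} {f : ℝ → ℝ} (hT : StrictMono T)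
    (h : TPlus a T f y ≠ ⊤) :
    ∃ m : ℕ, TPlus a T f y = (T (m + 1) : EReal) ∧ a < y + f (T (m + 1)) ∧
      ∀ k < m, y + f (T (k + 1)) ≤ a := by
  classical
  have hex : ∃ k : ℕ, a < y + f (T (k + 1)) := by
    by_contra! hno
    apply h
    refine sInf_eq_top.2 ?_
    rintro _ ⟨_, ⟨k, hk, rfl, hlt⟩, rfl⟩
    obtain ⟨j, rfl⟩ := Nat.exists_eq_add_of_le' hk
    exact absurd hlt (hno j).not_gt
  refine ⟨Nat.find hex, ?_, Nat.find_spec hex, fun k hk => not_lt.1 (Nat.find_min hex hk)⟩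
  refine IsLeast.csInf_eq ⟨⟨_, ⟨_, by omega, rfl, Nat.find_spec hex⟩, rfl⟩, ?_⟩
  rintro _ ⟨_, ⟨k, hk, rfl, hlt⟩, rfl⟩
  obtain ⟨j, rfl⟩ := Nat.exists_eq_add_of_le' hk
  exact EReal.coe_le_coe_iff.2 (hT.monotone (Nat.succ_le_succ (Nat.find_min' hex hlt)))

namespace IsPCTriple

variable {a y : ℝ} {T : ℕ → ℝ} {f U L R : ℝ → ℝ}

/-- While the free path has not left `[0, a]`, neither reflection has acted at the grid times. -/
theorem grid_eq (h : IsPCTriple a T f y U L R) (hT : IsTimeGrid T) {n : ℕ}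
    (hnn : ∀ s, 0 ≤ s → s ≤ T n → 0 ≤ y + f s) (hle : ∀ k < n, y + f (T (k + 1)) ≤ a) :
    ∀ k ≤ n, U (T k) = y + f (T k) ∧ L (T k) = 0 := by
  obtain ⟨hT0, hmono, -⟩ := hT
  intro k
  induction k with
  | zero =>
    intro _
    have h01 : T 0 < T 1 := hmono one_pos
    refine ⟨?_, h.L_first _ hT0.ge h01⟩
    rw [h.U_first _ hT0.ge h01, h.R_first _ hT0.ge h01, max_zero_neg_sInf_image_eq_zero, add_zero]
    rintro u ⟨h0, hu⟩
    exact hnn u h0 (hu.trans (hmono.monotone n.zero_le))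
  | succ k ih =>
    intro hk
    obtain ⟨hU, hL⟩ := ih (by omega)
    have hR : R (T (k + 1)) = R (T k) := by
      rw [h.R_jump, max_zero_neg_sInf_image_eq_zero, add_zero]
      rintro u ⟨h0, hu⟩
      have := hnn u ((hT0.ge.trans (hmono.monotone k.zero_le)).trans h0)
        (hu.trans (hmono.monotone hk))
      linarith
    have ha := hle k hk
    rw [h.U_jump, h.L_jump, hR, hL, hU, min_eq_left (by linarith), max_eq_right (by linarith)]
    constructor <;> ring

/-- Between grid times, the reflected path follows a free path that has stayed nonnegative. -/
theorem eq_of_mem_Ico (h : IsPCTriple a T f y U L R) {k : ℕ} {t : ℝ}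
    (hU : U (T k) = y + f (T k)) (hL : L (T k) = 0) (hkt : T k ≤ t) (htk : t < T (k + 1))
    (hnn : ∀ s ∈ Set.Icc (T k) t, 0 ≤ y + f s) : U t = y + f t ∧ L t = 0 := by
  rcases hkt.eq_or_lt with rfl | hlt
  · exact ⟨hU, hL⟩
  · have hR : R t = R (T k) := by
      rw [h.R_seg k t hlt htk, max_zero_neg_sInf_image_eq_zero, add_zero]
      intro u hu
      linarith [hnn u hu]
    rw [h.U_seg k t hlt htk, h.L_seg k t hlt htk, hR, hU, hL]
    exact ⟨by ring, rfl⟩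

/-- If the free path stays nonnegative up to `T (k + 1)` and exceeds `a` there, the upper
reflection acts at `T (k + 1)`. -/
theorem L_pos (h : IsPCTriple a T f y U L R) {k : ℕ}
    (hU : U (T k) = y + f (T k)) (hL : L (T k) = 0)
    (hnn : ∀ s ∈ Set.Icc (T k) (T (k + 1)), 0 ≤ y + f s) (ha : a < y + f (T (k + 1))) :
    0 < L (T (k + 1)) := by
  have hR : R (T (k + 1)) = R (T k) := by
    rw [h.R_jump, max_zero_neg_sInf_image_eq_zero, add_zero]
    intro u hu
    linarith [hnn u hu]
  rw [h.L_jump, hL, hR, hU, zero_add]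
  exact lt_max_of_lt_left (by linarith)

end IsPCTriple

/-- If `T_a^{(x),+} < τ_0^{(x),-}`, then on `[0, T_a^{(x),+})` one has `U⁽ˣ⁾ t = x + f t` and
`L⁽ˣ⁾ t = 0`; moreover `T_a^{(x),+} = inf {t ≥ 0 : L⁽ˣ⁾ t > 0}`. -/
theorem stmt2
    (a : ℝ) (ha : 0 ≤ a) (T : ℕ → ℝ) (hT : IsTimeGrid T)
    (f : ℝ → ℝ) (hf : CadlagFun f) (hf0 : f 0 = 0)
    (hfT : ∀ k : ℕ, 1 ≤ k → ContinuousAt f (T k))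
    (x : ℝ) (hx : 0 ≤ x)
    (U L R : ℝ → ℝ)
    (hx_triple : IsPCTriple a T f x U L R)
    (horder : TPlus a T f x < tauMinus f x) :
    (∀ t : ℝ, 0 ≤ t → (t : EReal) < TPlus a T f x → U t = x + f t ∧ L t = 0) ∧
    TPlus a T f x = sInf ((fun t : ℝ => (t : EReal)) '' {t : ℝ | 0 ≤ t ∧ 0 < L t}) := by
  obtain ⟨m, hTp, hexc, hle⟩ := exists_TPlus_eq hT.2.1 horder.ne_top
  rw [hTp] at horder ⊢
  have hmono := hT.2.1.monotone
  have hT_nonneg : ∀ k, 0 ≤ T k := fun k => hT.1.ge.trans (hmono k.zero_le)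
  have hnn : ∀ s, 0 ≤ s → s ≤ T (m + 1) → 0 ≤ x + f s := fun s h0 hs =>
    nonneg_of_lt_tauMinus h0 ((EReal.coe_le_coe_iff.2 hs).trans_lt horder)
  have hgrid := hx_triple.grid_eq hT
    (fun s h0 hs => hnn s h0 (hs.trans (hmono m.le_succ))) hle
  have hfree : ∀ t : ℝ, 0 ≤ t → t < T (m + 1) → U t = x + f t ∧ L t = 0 := by
    intro t h0 ht
    obtain ⟨k, hkt, htk⟩ := hT.exists_mem_Ico h0
    have hkm : k < m + 1 := hT.2.1.lt_iff_lt.1 (hkt.trans_lt ht)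
    obtain ⟨hU, hL⟩ := hgrid k (Nat.lt_succ_iff.1 hkm)
    exact hx_triple.eq_of_mem_Ico hU hL hkt htk
      fun s hs => hnn s ((hT_nonneg k).trans hs.1) (hs.2.trans ht.le)
  refine ⟨fun t h0 ht => hfree t h0 (EReal.coe_lt_coe_iff.1 ht), ?_⟩
  obtain ⟨hU, hL⟩ := hgrid m le_rfl
  have hpos := hx_triple.L_pos hU hL
    (fun s hs => hnn s ((hT_nonneg m).trans hs.1) hs.2) hexc
  symm
  refine IsLeast.csInf_eq ⟨⟨_, ⟨hT_nonneg _, hpos⟩, rfl⟩, ?_⟩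
  rintro _ ⟨t, ⟨h0, ht⟩, rfl⟩
  refine EReal.coe_le_coe_iff.2 (not_lt.1 fun hlt => ?_)
  exact ht.ne' (hfree t h0 hlt).2
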